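/- For every n ≥ 0 and every defect-0 β-pair (A,B) of rank n, the unordered pair Θ̄(A,B) belongs to X̃_{2n} and has defect 0, and Θ̄(A,B) = Θ̄(B,A); moreover Θ̄ is compatible with shifts and induces a well-defined bijection from the set of unordered defect-0 symbols of rank n (shift-equivalence classes of defect-0 β-pairs of rank n, taken up to swapping the two rows) onto 𝕏_{2n}^0. In particular, Θ̄ as a map on 𝕍_n^0 is surjective onto 𝕏_{2n}^0, and two classes have the same image exactly when they differ by swapping the rows. -/

import Mathlib

namespace CSpaper

/-- The rank of a β-set: the sum of its elements minus `choose (card) 2`. -/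
def bRank (B : Finset ℕ) : ℤ :=
  (∑ b ∈ B, (b : ℤ)) - (B.card.choose 2 : ℤ)

/-- The `k`-th shift of a β-set: `{0,…,k-1} ∪ {b+k : b ∈ B}`. -/
def bShift (k : ℕ) (B : Finset ℕ) : Finset ℕ :=
  Finset.range k ∪ B.image (· + k)

/-- Shift-equivalence of β-sets. -/
def sEquiv (A B : Finset ℕ) : Prop :=
  ∃ k, bShift k A = B ∨ A = bShift k B

/-- A β-pair: an ordered pair of β-sets. -/
abbrev BPair := Finset ℕ × Finset ℕ

/-- The defect of a β-pair. -/
def pDefect (Λ : BPair) : ℤ := (Λ.1.card : ℤ) - (Λ.2.card : ℤ)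

/-- The rank of a β-pair: `rk A + rk B + ⌊(d/2)²⌋`. -/
def pRank (Λ : BPair) : ℤ := bRank Λ.1 + bRank Λ.2 + pDefect Λ ^ 2 / 4

/-- The `k`-th shift of a β-pair. -/
def pShift (k : ℕ) (Λ : BPair) : BPair := (bShift k Λ.1, bShift k Λ.2)

/-- Shift-equivalence of β-pairs: one is a shift of the other. -/
def pEquiv (Λ Ξ : BPair) : Prop := ∃ k, pShift k Λ = Ξ ∨ Λ = pShift k Ξ

/-- `Λ` is a representative of a symbol in `𝕍_N^d`. -/
def inV (N d : ℤ) (Λ : BPair) : Prop := pRank Λ = N ∧ pDefect Λ = d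

/-- The `i`-th smallest element of a finite set of naturals (0-indexed). -/
def nthEl (A : Finset ℕ) (i : ℕ) : ℕ := (A.sort (· ≤ ·)).getD i 0

/-- The operation `A ⊙ B = {a_1+b_1, a_2+b_2-1, …, a_s+b_s-(s-1)}` (0-indexed:
`a_i + b_i - i`). -/
def odot (A B : Finset ℕ) : Finset ℕ :=
  (Finset.range A.card).image fun i => nthEl A i + nthEl B i - i

/-- Dominance order `B ⊴ A`: every tail sum of `B` is at most the corresponding
tail sum of `A`. -/
def domLE (B A : Finset ℕ) : Prop :=
  ∀ k, ∑ i ∈ Finset.Ico k B.card, nthEl B i ≤ ∑ i ∈ Finset.Ico k A.card, nthEl A i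

/-- No two consecutive integers. -/
def noConsec (S : Finset ℕ) : Prop := ∀ x ∈ S, x + 1 ∉ S

/-- `{0,2,…,2k-2} ∪ {x+2k : x ∈ S}`. -/
def evShift (k : ℕ) (S : Finset ℕ) : Finset ℕ :=
  (Finset.range k).image (fun i => 2 * i) ∪ S.image (· + 2 * k)

/-- `{1,3,…,2k-1} ∪ {y+2k : y ∈ S}`. -/
def odShift (k : ℕ) (S : Finset ℕ) : Finset ℕ :=
  (Finset.range k).image (fun i => 2 * i + 1) ∪ S.image (· + 2 * k)

/-- The `k`-th shift in the 𝕐-family. -/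
def yShift (k : ℕ) (P : BPair) : BPair := (evShift k P.1, odShift k P.2)

/-- The `k`-th shift in the 𝕏-family. -/
def xShift (k : ℕ) (P : BPair) : BPair := (evShift k P.1, evShift k P.2)

/-- Shift-equivalence in the 𝕐-family. -/
def yEquiv (P Q : BPair) : Prop := ∃ k, yShift k P = Q ∨ P = yShift k Q

/-- Shift-equivalence in the 𝕏-family (unordered pairs, so swaps are allowed). -/
def xEquiv (P Q : BPair) : Prop :=
  ∃ k, xShift k P = Q ∨ xShift k P = Q.swap ∨ P = xShift k Q ∨ P.swap = xShift k Q

/-- Membership in `Ỹ_N`. -/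
def inYtilde (N : ℤ) (P : BPair) : Prop :=
  (∀ y ∈ P.2, 0 < y) ∧ Odd (P.1.card + P.2.card) ∧ noConsec P.1 ∧ noConsec P.2 ∧
    2 * ((∑ x ∈ P.1, (x : ℤ)) + ∑ y ∈ P.2, (y : ℤ)) =
      N + ((P.1.card + P.2.card : ℕ) : ℤ) * (((P.1.card + P.2.card : ℕ) : ℤ) - 1)

/-- The defect in the 𝕐-family: `|X| - |Y|`. -/
def yDefect (P : BPair) : ℤ := (P.1.card : ℤ) - (P.2.card : ℤ)

/-- Membership in `X̃_N`. -/
def inXtilde (N : ℤ) (P : BPair) : Prop :=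
  noConsec P.1 ∧ noConsec P.2 ∧
    2 * ((∑ x ∈ P.1, (x : ℤ)) + ∑ y ∈ P.2, (y : ℤ)) =
      N + (((P.1.card + P.2.card : ℕ) : ℤ) - 1) ^ 2 - 1

/-- The defect in the 𝕏-family: `||A| - |B||`. -/
def xDefect (P : BPair) : ℤ := |(P.1.card : ℤ) - (P.2.card : ℤ)|

/-- The map `Θ(A,B) = ({0, a_1+2, …, a_s+s+1}, {b_1+1, …, b_s+s})`. -/
def theta (Λ : BPair) : BPair :=
  (insert 0 ((Finset.range Λ.1.card).image fun i => nthEl Λ.1 i + i + 2),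
   (Finset.range Λ.2.card).image fun i => nthEl Λ.2 i + i + 1)

/-- The map `Θ'(A,B) = ({0, a_1+2, …, a_s+s+1}, {b_1, …, b_s+s-1})`. -/
def theta' (Λ : BPair) : BPair :=
  (insert 0 ((Finset.range Λ.1.card).image fun i => nthEl Λ.1 i + i + 2),
   (Finset.range Λ.2.card).image fun i => nthEl Λ.2 i + i)

/-- The map `Θ̄(A,B) = ({a_1, …, a_s+s-1}, {b_1, …, b_s+s-1})`. -/
def thetaBar (Λ : BPair) : BPair :=
  ((Finset.range Λ.1.card).image fun i => nthEl Λ.1 i + i,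
   (Finset.range Λ.2.card).image fun i => nthEl Λ.2 i + i)

/-- `ᵀΘ(A,B) = Θ(B,A)`. -/
def thetaT (Λ : BPair) : BPair := theta (Λ.2, Λ.1)

/-- `Π^d` for `d ≥ 1`: adjoin `{0,2,…,2d-4}` to the first row and add `2d-2`
to its entries. -/
def piPos (d : ℕ) (P : BPair) : BPair := (evShift (d - 1) P.1, P.2)

/-- `Π^d` for `d = -e ≤ -1`: adjoin `{1,3,…,2e+1}` to the second row and add
`2e+2` to its entries. -/
def piNeg (e : ℕ) (P : BPair) : BPair := (P.1, odShift (e + 1) P.2)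

/-- `Δ_B^t = Π^{2t+1} ∘ Θ'`. -/
def deltaB (t : ℕ) (Λ : BPair) : BPair := piPos (2 * t + 1) (theta' Λ)

/-- `Δ_C^t = Π^{4t+1} ∘ Θ`. -/
def deltaC (t : ℕ) (Λ : BPair) : BPair := piPos (4 * t + 1) (theta Λ)

/-- `Δ_{C'}^t = Π^{1-4t} ∘ ᵀΘ` (for `t ≥ 1`). -/
def deltaC' (t : ℕ) (Λ : BPair) : BPair := piNeg (4 * t - 1) (thetaT Λ)

/-- `Δ_D^t = Π^{4t} ∘ Θ'` (for `t ≥ 1`). -/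
def deltaD (t : ℕ) (Λ : BPair) : BPair := piPos (4 * t) (theta' Λ)

/-- `Δ_D^0 = Θ̄`. -/
def deltaD0 (Λ : BPair) : BPair := thetaBar Λ

/-- All entries of a pair (with multiplicity) in weakly increasing order. -/
def entries (P : BPair) : List ℕ := (P.1.val + P.2.val).sort (· ≤ ·)

/-- `Σ_j (len-1-j) ⬝ (L[j] - ref j)`, the common shape of `a`, `b` and `σ`. -/
def wsum (L : List ℕ) (ref : ℕ → ℕ) : ℤ :=
  ∑ j ∈ Finset.range L.length,
    ((L.length - 1 - j : ℕ) : ℤ) * ((L.getD j 0 : ℤ) - (ref j : ℤ))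

/-- Lusztig's a-function (reference sequence `0,0,1,1,…`). -/
def aFun (P : BPair) : ℤ := wsum (entries P) (fun j => j / 2)

/-- Lusztig's b-function with the 𝕏-reference sequence `0,0,2,2,…`. -/
def bX (P : BPair) : ℤ := wsum (entries P) (fun j => 2 * (j / 2))

/-- Lusztig's b-function with the 𝕐-reference sequence `0,1,2,…`. -/
def bY (P : BPair) : ℤ := wsum (entries P) (fun j => j)

/-- `σ(Λ) = Σ (2k-i)·x_i`. -/
def sigmaFun (P : BPair) : ℤ := wsum (entries P) (fun _ => 0)

/-- Entrywise sum of two rows (of equal size), sorted positions added. -/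
def addRows (X X' : Finset ℕ) : Finset ℕ :=
  (Finset.range X.card).image fun i => nthEl X i + nthEl X' i

/-- `Λ ⊕ Ξ` in the types B and D cases. -/
def oplus (Λ Ξ : BPair) : BPair := (addRows Λ.1 Ξ.1, addRows Λ.2 Ξ.2)

/-- `Λ ⊕ Ξ` in the type C case. -/
def oplusC (Λ Ξ : BPair) : BPair :=
  (insert (nthEl Ξ.1 0)
      ((Finset.range Λ.1.card).image fun i => nthEl Λ.1 i + nthEl Ξ.1 (i + 1) + 1),
   (Finset.range Λ.2.card).image fun j => nthEl Λ.2 j + nthEl Ξ.2 j + 1)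

/-- `Λ ⊞ Ξ`: the twisted combination in type D. -/
def boxplus (Λ Ξ : BPair) : BPair := (addRows Λ.2 Ξ.1, addRows Λ.1 Ξ.2)

/-- Similarity of β-pairs: after shifts, the row unions and row intersections
coincide. -/
def pSimilar (Λ Ξ : BPair) : Prop :=
  ∃ j k, (pShift j Λ).1 ∪ (pShift j Λ).2 = (pShift k Ξ).1 ∪ (pShift k Ξ).2 ∧
    (pShift j Λ).1 ∩ (pShift j Λ).2 = (pShift k Ξ).1 ∩ (pShift k Ξ).2

/-- Similarity in the 𝕏-family: after 𝕏-shifts, the row unions and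
intersections coincide. -/
def xSimilar (P Q : BPair) : Prop :=
  ∃ j k, (xShift j P).1 ∪ (xShift j P).2 = (xShift k Q).1 ∪ (xShift k Q).2 ∧
    (xShift j P).1 ∩ (xShift j P).2 = (xShift k Q).1 ∩ (xShift k Q).2

/-- A β-pair is reduced if it is not a proper shift, i.e. `0` does not lie in
both rows; each shift-equivalence class has a unique reduced representative. -/
def reduced (Λ : BPair) : Prop := ¬ (0 ∈ Λ.1 ∧ 0 ∈ Λ.2)

/-- `a(Λ) + a(Ξ) = b(Λ⊕Ξ)`, computed (as in the paper) on shift-representatives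
with matching row sizes. -/
def minimalPair (Λ Ξ : BPair) : Prop :=
  ∃ Λ' Ξ', pEquiv Λ Λ' ∧ pEquiv Ξ Ξ' ∧ Λ'.1.card = Ξ'.1.card ∧
    Λ'.2.card = Ξ'.2.card ∧ aFun Λ' + aFun Ξ' = bX (oplus Λ' Ξ')

/-- The generating relation `i ≈ i+1` whenever `c_i = c_{i+1}` or `d_i = d_{i+1}`. -/
def linkRel (n : ℕ) (c d : ℕ → ℕ) (i j : Fin n) : Prop :=
  (j : ℕ) = (i : ℕ) + 1 ∧ (c i = c j ∨ d i = d j)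

/-- The equivalence relation generated by `linkRel`. -/
def idxSetoid (n : ℕ) (c d : ℕ → ℕ) : Setoid (Fin n) :=
  ⟨Relation.EqvGen (linkRel n c d), Relation.EqvGen.is_equivalence _⟩

/-- A degenerate equivalence class: `{i, i+1}` with `c_i = c_{i+1}` and
`d_i = d_{i+1}`. -/
def degenClass (n : ℕ) (c d : ℕ → ℕ) (Q : Quotient (idxSetoid n c d)) : Prop :=
  ∃ i j : Fin n, (j : ℕ) = (i : ℕ) + 1 ∧ c i = c j ∧ d i = d j ∧
    Q = Quotient.mk (idxSetoid n c d) i ∧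
    ∀ m : Fin n, Quotient.mk (idxSetoid n c d) m = Q → m = i ∨ m = j

/-- The number `ℓ` of non-degenerate equivalence classes. -/
noncomputable def ellCount (n : ℕ) (c d : ℕ → ℕ) : ℕ :=
  Nat.card {Q : Quotient (idxSetoid n c d) // ¬ degenClass n c d Q}

/-- `Ξ` is obtained from `Λ` by decreasing a single entry by `1`, the result
again being a β-pair. -/
def stepDown (Λ Ξ : BPair) : Prop :=
  (∃ x ∈ Λ.1, 0 < x ∧ x - 1 ∉ Λ.1 ∧ Ξ = (insert (x - 1) (Λ.1.erase x), Λ.2)) ∨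
  (∃ x ∈ Λ.2, 0 < x ∧ x - 1 ∉ Λ.2 ∧ Ξ = (Λ.1, insert (x - 1) (Λ.2.erase x)))

/-- One row of `Θ̄`: `{a_1, a_2+1, …, a_s+s-1}`. -/
def spread (A : Finset ℕ) : Finset ℕ :=
  (Finset.range A.card).image fun i => nthEl A i + i

theorem sort_insert_of_lt {A : Finset ℕ} {m : ℕ} (h : ∀ a ∈ A, a < m) :
    (insert m A).sort (· ≤ ·) = A.sort (· ≤ ·) ++ [m] := by
  have hp : (A.sort (· ≤ ·) ++ [m]).Pairwise (· ≤ ·) := by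
    rw [List.pairwise_append]
    refine ⟨Finset.pairwise_sort _ _, by simp, fun a ha b hb => ?_⟩
    rw [Finset.mem_sort] at ha
    rw [List.mem_singleton] at hb
    exact hb ▸ (h a ha).le
  have hd : (A.sort (· ≤ ·) ++ [m]).Nodup := by
    rw [List.nodup_append]
    refine ⟨Finset.sort_nodup _ _, by simp, fun a ha b hb => ?_⟩
    rw [Finset.mem_sort] at ha
    rw [List.mem_singleton] at hb
    exact hb ▸ (h a ha).ne
  rw [← (List.toFinset_sort (· ≤ ·) hd).2 hp]
  congr 1
  ext x
  simp

theorem nthEl_insert_of_lt_card {A : Finset ℕ} {m i : ℕ} (h : ∀ a ∈ A, a < m) (hi : i < A.card) :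
    nthEl (insert m A) i = nthEl A i := by
  rw [nthEl, nthEl, sort_insert_of_lt h, List.getD_append _ _ _ _ (by simpa using hi)]

theorem nthEl_insert_card {A : Finset ℕ} {m : ℕ} (h : ∀ a ∈ A, a < m) :
    nthEl (insert m A) A.card = m := by
  rw [nthEl, sort_insert_of_lt h, List.getD_append_right _ _ _ _ (by simp)]
  simp

theorem notMem_of_forall_lt {A : Finset ℕ} {m : ℕ} (h : ∀ a ∈ A, a < m) : m ∉ A :=
  fun hm => lt_irrefl _ (h m hm)

@[simp]
theorem spread_empty : spread ∅ = ∅ := rfl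

theorem spread_insert {A : Finset ℕ} {m : ℕ} (h : ∀ a ∈ A, a < m) :
    spread (insert m A) = insert (m + A.card) (spread A) := by
  rw [spread, Finset.card_insert_of_notMem (notMem_of_forall_lt h), Finset.range_add_one,
    Finset.image_insert, nthEl_insert_card h]
  congr 1
  refine Finset.image_congr fun i hi => ?_
  simp only [Finset.coe_range, Set.mem_Iio] at hi
  simp only [nthEl_insert_of_lt_card h hi]

theorem spread_add_one_lt {A : Finset ℕ} {m : ℕ} (h : ∀ a ∈ A, a < m) :
    ∀ t ∈ spread A, t + 1 < m + A.card := by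
  induction A using Finset.induction_on_max generalizing m with
  | empty => simp
  | insert M A hM ih =>
    intro t ht
    rw [Finset.card_insert_of_notMem (notMem_of_forall_lt hM)]
    have hMm := h M (Finset.mem_insert_self _ _)
    rw [spread_insert hM, Finset.mem_insert] at ht
    rcases ht with rfl | ht
    · omega
    · have := ih hM t ht
      omega

theorem notMem_spread {A : Finset ℕ} {m : ℕ} (h : ∀ a ∈ A, a < m) : m + A.card ∉ spread A :=
  fun hm => absurd (spread_add_one_lt h _ hm) (by omega)

@[simp]
theorem card_spread (A : Finset ℕ) : (spread A).card = A.card := by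
  induction A using Finset.induction_on_max with
  | empty => rfl
  | insert M A hM ih =>
    rw [spread_insert hM, Finset.card_insert_of_notMem (notMem_spread hM),
      Finset.card_insert_of_notMem (notMem_of_forall_lt hM), ih]

theorem sum_spread (A : Finset ℕ) :
    ∑ x ∈ spread A, (x : ℤ) = ∑ a ∈ A, (a : ℤ) + (A.card.choose 2 : ℤ) := by
  induction A using Finset.induction_on_max with
  | empty => rfl
  | insert M A hM ih =>
    rw [spread_insert hM, Finset.sum_insert (notMem_spread hM),
      Finset.sum_insert (notMem_of_forall_lt hM),
      Finset.card_insert_of_notMem (notMem_of_forall_lt hM), ih, Nat.choose_succ_succ' A.card 1]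
    push_cast
    rw [Nat.choose_one_right]
    ring

theorem noConsec_spread (A : Finset ℕ) : noConsec (spread A) := by
  induction A using Finset.induction_on_max with
  | empty => simp [noConsec]
  | insert M A hM ih =>
    intro x hx hx'
    have hlt := spread_add_one_lt hM
    rw [spread_insert hM, Finset.mem_insert] at hx hx'
    rcases hx with rfl | hx <;> rcases hx' with hx' | hx'
    · omega
    · have := hlt _ hx'
      omega
    · have := hlt _ hx
      omega
    · exact ih x hx hx'

theorem add_card_lt_of_spread {A : Finset ℕ} {m : ℕ} (h : ∀ t ∈ spread A, t + 1 < m) :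
    A.card ≤ m ∧ ∀ a ∈ A, a + A.card < m := by
  induction A using Finset.induction_on_max with
  | empty => simp
  | insert M A hM ih =>
    rw [Finset.card_insert_of_notMem (notMem_of_forall_lt hM)]
    have hMm := h (M + A.card) (by simp [spread_insert hM])
    refine ⟨by omega, fun a ha => ?_⟩
    rcases Finset.mem_insert.1 ha with rfl | ha
    · omega
    · have := hM a ha
      omega

theorem exists_spread_eq {Q : Finset ℕ} (hQ : noConsec Q) : ∃ A, spread A = Q := by
  induction Q using Finset.induction_on_max with
  | empty => exact ⟨∅, rfl⟩
  | insert m Q hm ih =>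
    obtain ⟨A, rfl⟩ := ih fun x hx hx' =>
      hQ x (Finset.mem_insert_of_mem hx) (Finset.mem_insert_of_mem hx')
    obtain ⟨hle, hlt⟩ := add_card_lt_of_spread (A := A) (m := m) fun t ht => by
      refine lt_of_le_of_ne (hm t ht) fun he => hQ t (Finset.mem_insert_of_mem ht) ?_
      rw [he]
      exact Finset.mem_insert_self _ _
    refine ⟨insert (m - A.card) A, ?_⟩
    rw [spread_insert fun a ha => by have := hlt a ha; omega, Nat.sub_add_cancel hle]

theorem spread_injective : Function.Injective spread := by
  intro A
  induction A using Finset.induction_on_max with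
  | empty =>
    intro B h
    have := congrArg Finset.card h
    rw [card_spread, card_spread] at this
    exact (Finset.card_eq_zero.1 this.symm).symm
  | insert M A hM ih =>
    intro B h
    induction B using Finset.induction_on_max with
    | empty =>
      have := congrArg Finset.card h
      simp at this
    | insert M' B hM' =>
      have hc := congrArg Finset.card h
      rw [card_spread, card_spread, Finset.card_insert_of_notMem (notMem_of_forall_lt hM),
        Finset.card_insert_of_notMem (notMem_of_forall_lt hM'), add_left_inj] at hc
      rw [spread_insert hM, spread_insert hM'] at h
      have hMM : M = M' := by
        have h₁ : M + A.card ∈ insert (M' + B.card) (spread B) :=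
          h ▸ Finset.mem_insert_self _ _
        have h₂ : M' + B.card ∈ insert (M + A.card) (spread A) :=
          h ▸ Finset.mem_insert_self _ _
        rw [Finset.mem_insert] at h₁ h₂
        rcases h₁ with h₁ | h₁
        · omega
        rcases h₂ with h₂ | h₂
        · omega
        have := spread_add_one_lt hM' _ h₁
        have := spread_add_one_lt hM _ h₂
        omega
      subst hMM
      have hAB := congrArg (Finset.erase · (M + A.card)) h
      rw [Finset.erase_insert (notMem_spread hM), hc,
        Finset.erase_insert (notMem_spread hM')] at hAB
      rw [ih hAB]

theorem bShift_insert (k m : ℕ) (A : Finset ℕ) :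
    bShift k (insert m A) = insert (m + k) (bShift k A) := by
  rw [bShift, bShift, Finset.image_insert, Finset.union_insert]

theorem evShift_insert (k m : ℕ) (A : Finset ℕ) :
    evShift k (insert m A) = insert (m + 2 * k) (evShift k A) := by
  rw [evShift, evShift, Finset.image_insert, Finset.union_insert]

theorem bShift_lt {k m : ℕ} {A : Finset ℕ} (h : ∀ a ∈ A, a < m) : ∀ x ∈ bShift k A, x < m + k := by
  intro x hx
  simp only [bShift, Finset.mem_union, Finset.mem_range, Finset.mem_image] at hx
  rcases hx with hx | ⟨a, ha, rfl⟩
  · omega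
  · have := h a ha
    omega

theorem card_bShift (k : ℕ) (A : Finset ℕ) : (bShift k A).card = A.card + k := by
  induction A using Finset.induction_on_max with
  | empty => simp [bShift]
  | insert M A hM ih =>
    rw [bShift_insert, Finset.card_insert_of_notMem (notMem_of_forall_lt (bShift_lt hM)), ih,
      Finset.card_insert_of_notMem (notMem_of_forall_lt hM)]
    omega

theorem spread_range (k : ℕ) :
    spread (Finset.range k) = (Finset.range k).image (fun i => 2 * i) := by
  induction k with
  | zero => rfl
  | succ k ih =>
    rw [Finset.range_add_one, spread_insert (by simp), Finset.image_insert, ih, Finset.card_range,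
      two_mul]

theorem spread_bShift (k : ℕ) (A : Finset ℕ) : spread (bShift k A) = evShift k (spread A) := by
  induction A using Finset.induction_on_max with
  | empty => simp [bShift, evShift, spread_range]
  | insert M A hM ih =>
    rw [bShift_insert, spread_insert (bShift_lt hM), spread_insert hM, evShift_insert, ih,
      card_bShift]
    congr 1
    omega

theorem thetaBar_eq (Λ : BPair) : thetaBar Λ = (spread Λ.1, spread Λ.2) := rfl

theorem thetaBar_injective : Function.Injective thetaBar := fun _ _ h =>
  Prod.ext (spread_injective (congrArg Prod.fst h)) (spread_injective (congrArg Prod.snd h))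

theorem thetaBar_swap (Λ : BPair) : thetaBar Λ.swap = (thetaBar Λ).swap := rfl

theorem thetaBar_pShift (k : ℕ) (Λ : BPair) : thetaBar (pShift k Λ) = xShift k (thetaBar Λ) := by
  rw [thetaBar_eq, thetaBar_eq, pShift, xShift, spread_bShift, spread_bShift]

theorem xEquiv_thetaBar_iff (Λ Ξ : BPair) :
    xEquiv (thetaBar Λ) (thetaBar Ξ) ↔ pEquiv Λ Ξ ∨ pEquiv Λ Ξ.swap := by
  have hswap (k : ℕ) : Λ.swap = pShift k Ξ ↔ Λ = pShift k Ξ.swap := Prod.swap_inj.symm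
  simp only [xEquiv, pEquiv, ← thetaBar_pShift, ← thetaBar_swap, thetaBar_injective.eq_iff,
    ← exists_or, hswap]
  refine exists_congr fun k => ?_
  tauto

theorem xDefect_thetaBar (Λ : BPair) : xDefect (thetaBar Λ) = |pDefect Λ| := by
  simp only [xDefect, pDefect, thetaBar_eq, card_spread]

theorem two_mul_choose_two (s : ℕ) : 2 * (s.choose 2 : ℤ) = s * (s - 1) := by
  induction s with
  | zero => rfl
  | succ s ih =>
    rw [Nat.choose_succ_succ' s 1, Nat.choose_one_right]
    push_cast
    linarith

theorem inXtilde_thetaBar_iff (N : ℤ) {Λ : BPair} (h : pDefect Λ = 0) :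
    inXtilde (2 * N) (thetaBar Λ) ↔ pRank Λ = N := by
  have hc : (Λ.1.card : ℤ) = Λ.2.card := sub_eq_zero.1 h
  have hc' : Λ.1.card = Λ.2.card := by exact_mod_cast hc
  have hs := two_mul_choose_two Λ.2.card
  simp only [inXtilde, thetaBar_eq, noConsec_spread, sum_spread, card_spread, pRank, bRank, h, hc',
    true_and]
  push_cast
  constructor <;> intro H <;> norm_num at H ⊢ <;> nlinarith

/-- `Θ̄` sends rank-`n` defect-`0` β-pairs into `X̃_{2n}` with
defect `0`, satisfies `Θ̄(A,B) = Θ̄(B,A)` (as unordered pairs), is compatible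
with shifts, and induces a bijection from unordered defect-`0` symbols of
rank `n` onto `𝕏_{2n}^0`; two classes have the same image exactly when they
differ by swapping the rows. -/
theorem statement_7 (n : ℕ) :
    (∀ Λ : BPair, inV n 0 Λ →
      inXtilde (2 * n) (thetaBar Λ) ∧ xDefect (thetaBar Λ) = 0 ∧
      thetaBar (Λ.2, Λ.1) = ((thetaBar Λ).2, (thetaBar Λ).1)) ∧
    (∀ Λ : BPair, inV n 0 Λ → thetaBar (pShift 1 Λ) = xShift 1 (thetaBar Λ)) ∧
    (∀ Λ Ξ : BPair, inV n 0 Λ → inV n 0 Ξ →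
      ((pEquiv Λ Ξ ∨ pEquiv Λ (Ξ.2, Ξ.1)) ↔ xEquiv (thetaBar Λ) (thetaBar Ξ))) ∧
    (∀ Q : BPair, inXtilde (2 * n) Q → xDefect Q = 0 →
      ∃ Λ : BPair, inV n 0 Λ ∧ xEquiv (thetaBar Λ) Q) := by
  refine ⟨fun Λ h => ⟨(inXtilde_thetaBar_iff n h.2).2 h.1, ?_, rfl⟩,
    fun Λ _ => thetaBar_pShift 1 Λ, fun Λ Ξ _ _ => (xEquiv_thetaBar_iff Λ Ξ).symm, ?_⟩
  · rw [xDefect_thetaBar, h.2, abs_zero]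
  · rintro ⟨P, Q⟩ hPQ hd
    obtain ⟨A, rfl⟩ := exists_spread_eq hPQ.1
    obtain ⟨B, rfl⟩ := exists_spread_eq hPQ.2.1
    have hd' : pDefect (A, B) = 0 := abs_eq_zero.1 (xDefect_thetaBar (A, B) ▸ hd)
    refine ⟨(A, B), ⟨(inXtilde_thetaBar_iff n hd').1 hPQ, hd'⟩, 0, Or.inl ?_⟩
    simp [xShift, evShift, thetaBar_eq]

end CSpaper
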